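/- Let C be an m×n Cauchon diagram and let I ⊆ [m], J ⊆ [n] with |I| = |J| = k. If there does not exist a vertex-disjoint (R_I,C_J)-path system in the Cauchon graph G_C, then det_q(M_C[I,J]) = 0. -/

import Mathlib

universe u

/-- Quantum affine space data: a central unit `q` and units `t i j`
satisfying the quantum affine space commutation relations. -/
structure QMData (R : Type u) [Ring R] (m n : ℕ) where
  q : Rˣ
  t : Fin m → Fin n → Rˣ
  q_central : ∀ r : R, (q : R) * r = r * (q : R)
  row_rel : ∀ (i : Fin m) ⦃j j' : Fin n⦄, j < j' →
    (t i j : R) * (t i j' : R) = (q : R) * ((t i j' : R) * (t i j : R))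
  col_rel : ∀ ⦃i i' : Fin m⦄ (j : Fin n), i < i' →
    (t i j : R) * (t i' j : R) = (q : R) * ((t i' j : R) * (t i j : R))
  mixed_rel : ∀ ⦃i i' : Fin m⦄ ⦃j j' : Fin n⦄, i < i' → j ≠ j' →
    (t i j : R) * (t i' j' : R) = (t i' j' : R) * (t i j : R)

/-- `white i j = true` means the square `(i,j)` is white.  The Cauchon
condition: for every black square, either every square above it or every
square to its left is also black. -/
def IsCauchon {m n : ℕ} (white : Fin m → Fin n → Bool) : Prop :=
  ∀ i j, white i j = false →
    (∀ i' : Fin m, i' < i → white i' j = false) ∨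
    (∀ j' : Fin n, j' < j → white i j' = false)

/-- Vertices of the Cauchon graph: white squares, row vertices `r_i`,
column vertices `c_j`. -/
inductive CVertex (m n : ℕ) where
  | sq : Fin m → Fin n → CVertex m n
  | row : Fin m → CVertex m n
  | col : Fin n → CVertex m n
deriving DecidableEq

/-- Directed edges of the Cauchon graph. -/
inductive CEdge {m n : ℕ} (white : Fin m → Fin n → Bool) :
    CVertex m n → CVertex m n → Prop where
  | fromRow (i : Fin m) (k : Fin n) :
      white i k = true → (∀ k' : Fin n, k < k' → white i k' = false) →
      CEdge white (.row i) (.sq i k)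
  | toCol (i : Fin m) (j : Fin n) :
      white i j = true → (∀ i' : Fin m, i < i' → white i' j = false) →
      CEdge white (.sq i j) (.col j)
  | horiz (i : Fin m) (k j : Fin n) :
      j < k → white i k = true → white i j = true →
      (∀ j' : Fin n, j < j' → j' < k → white i j' = false) →
      CEdge white (.sq i k) (.sq i j)
  | vert (i i' : Fin m) (j : Fin n) :
      i < i' → white i j = true → white i' j = true →
      (∀ l : Fin m, i < l → l < i' → white l j = false) →
      CEdge white (.sq i j) (.sq i' j)

/-- The weight of an edge of the Cauchon graph (1 on non-edges). -/
def wt {R : Type u} {m n : ℕ} [Ring R] (D : QMData R m n) :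
    CVertex m n → CVertex m n → R
  | .row i, .sq i' k => if i = i' then (D.t i' k : R) else 1
  | .sq i k, .sq i' j =>
      if i = i' ∧ j < k then (↑((D.t i k)⁻¹) * ↑(D.t i j) : R) else 1
  | _, _ => 1

/-- A pair of vertices spans a horizontal edge (edges from `r_i` are
horizontal; edges between squares are horizontal iff the rows agree). -/
def Horiz {m n : ℕ} : CVertex m n → CVertex m n → Prop
  | .row _, _ => True
  | .sq i _, .sq i' _ => i = i'
  | _, _ => False

/-- `l` is (the list of vertices of) a directed path from `u` to `v`. -/
def IsPathFrom {m n : ℕ} (white : Fin m → Fin n → Bool) (u v : CVertex m n)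
    (l : List (CVertex m n)) : Prop :=
  l.Chain' (CEdge white) ∧ l.head? = some u ∧ l.getLast? = some v

/-- The list of (endpoint pairs of the) edges of a path. -/
def steps {m n : ℕ} (l : List (CVertex m n)) : List (CVertex m n × CVertex m n) :=
  l.zip l.tail

/-- The weight of a path: the ordered product of its edge weights. -/
def pathWeight {R : Type u} {m n : ℕ} [Ring R] (D : QMData R m n)
    (l : List (CVertex m n)) : R :=
  ((steps l).map fun p => wt D p.1 p.2).prod

/-- The number of inversions (length) of a permutation of `Fin k`. -/
def invCount {k : ℕ} (σ : Equiv.Perm (Fin k)) : ℕ :=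
  ((Finset.univ : Finset (Fin k × Fin k)).filter fun p => p.1 < p.2 ∧ σ p.2 < σ p.1).card

/-- The quantum determinant of a `k × k` matrix over a (noncommutative) ring. -/
def qdet {R : Type u} [Ring R] {k : ℕ} (q : Rˣ) (N : Matrix (Fin k) (Fin k) R) : R :=
  ∑ σ : Equiv.Perm (Fin k),
    (-(q : R)) ^ invCount σ * ((List.finRange k).map fun i => N i (σ i)).prod

/-- The path matrix: entry `(i,j)` is the sum of the weights of all directed
paths from `r_i` to `c_j` (zero when there are none). -/
noncomputable def pathMatrix {R : Type u} {m n : ℕ} [Ring R] (D : QMData R m n)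
    (white : Fin m → Fin n → Bool) : Matrix (Fin m) (Fin n) R :=
  Matrix.of fun i j =>
    ∑ᶠ p : {l : List (CVertex m n) // IsPathFrom white (.row i) (.col j) l},
      pathWeight D p.1

/-- An `(R_I, C_J)`-path system: paths `P ℓ : r_{i_ℓ} ⇒ c_{j_{σ ℓ}}`. -/
structure PathSys {m n : ℕ} (white : Fin m → Fin n → Bool) {k : ℕ}
    (ι : Fin k → Fin m) (κ : Fin k → Fin n) where
  σ : Equiv.Perm (Fin k)
  P : Fin k → List (CVertex m n)
  isPath : ∀ l : Fin k, IsPathFrom white (.row (ι l)) (.col (κ (σ l))) (P l)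

/-- A path system is vertex-disjoint if no two of its paths share a vertex. -/
def PathSys.VertexDisjoint {m n : ℕ} {white : Fin m → Fin n → Bool} {k : ℕ}
    {ι : Fin k → Fin m} {κ : Fin k → Fin n} (S : PathSys white ι κ) : Prop :=
  ∀ a b : Fin k, a ≠ b → ∀ x : CVertex m n, x ∈ S.P a → x ∈ S.P b → False

/-- The weight of a path system: the ordered product `w(P₁)⋯w(P_k)`. -/
def PathSys.weight {R : Type u} {m n : ℕ} [Ring R] (D : QMData R m n)
    {white : Fin m → Fin n → Bool} {k : ℕ} {ι : Fin k → Fin m} {κ : Fin k → Fin n}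
    (S : PathSys white ι κ) : R :=
  ((List.finRange k).map fun l => pathWeight D (S.P l)).prod

/-- The `q`-sign of a path system: `(-q) ^ ℓ(σ_P)`. -/
def PathSys.sgnq {R : Type u} {m n : ℕ} [Ring R] (D : QMData R m n)
    {white : Fin m → Fin n → Bool} {k : ℕ} {ι : Fin k → Fin m} {κ : Fin k → Fin n}
    (S : PathSys white ι κ) : R :=
  (-(D.q : R)) ^ invCount S.σ


namespace CauchonGraph

section QCommutation

variable {R : Type u} [Ring R] {m n : ℕ}

/-- `x` and `y` commute up to the factor `q ^ e`. -/
def QComm (D : QMData R m n) (e : ℤ) (x y : R) : Prop :=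
  x * y = ((D.q ^ e : Rˣ) : R) * (y * x)

theorem commute_zpow (D : QMData R m n) (e : ℤ) (r : R) :
    Commute ((D.q ^ e : Rˣ) : R) r :=
  Commute.units_zpow_left (D.q_central r) e

namespace QComm

variable {D : QMData R m n} {e f : ℤ} {x y z : R}

theorem zero_right : QComm D e x 0 := by simp [QComm]

theorem add (h : QComm D e x y) (h' : QComm D e x z) : QComm D e x (y + z) := by
  unfold QComm at *
  rw [mul_add, h, h', add_mul, mul_add]

theorem mul_right (h : QComm D e x y) (h' : QComm D f x z) : QComm D (e + f) x (y * z) := by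
  unfold QComm at *
  calc x * (y * z) = ((D.q ^ e : Rˣ) : R) * (y * (x * z)) := by
        rw [← mul_assoc, h]; simp only [mul_assoc]
    _ = ((D.q ^ e : Rˣ) : R) * (((D.q ^ f : Rˣ) : R) * (y * (z * x))) := by
        rw [h', (commute_zpow D f y).symm.left_comm]
    _ = _ := by rw [zpow_add]; simp only [Units.val_mul, mul_assoc]

theorem mul_left (h : QComm D e x z) (h' : QComm D f y z) : QComm D (e + f) (x * y) z := by
  unfold QComm at *
  calc x * y * z = ((D.q ^ f : Rˣ) : R) * (x * z * y) := by
        rw [mul_assoc, h', (commute_zpow D f x).symm.left_comm]; simp only [mul_assoc]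
    _ = ((D.q ^ f : Rˣ) : R) * (((D.q ^ e : Rˣ) : R) * (z * (x * y))) := by
        rw [h]; simp only [mul_assoc]
    _ = _ := by rw [add_comm, zpow_add]; simp only [Units.val_mul, mul_assoc]

theorem inv_right {w : Rˣ} (h : QComm D e x w) : QComm D (-e) x ((w⁻¹ : Rˣ) : R) := by
  unfold QComm at *
  have key : (w⁻¹ : Rˣ) * x = ((D.q ^ e : Rˣ) : R) * (x * (w⁻¹ : Rˣ)) := by
    calc (w⁻¹ : Rˣ) * x = (w⁻¹ : Rˣ) * (x * w) * (w⁻¹ : Rˣ) := by simp [mul_assoc]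
      _ = (((w⁻¹ : Rˣ) : R) * ((D.q ^ e : Rˣ) : R)) * (w * x) * (w⁻¹ : Rˣ) := by
        rw [h]; simp only [mul_assoc]
      _ = _ := by rw [← (commute_zpow D e _).eq]; simp [mul_assoc]
  rw [key, ← mul_assoc, ← Units.val_mul, ← zpow_add]
  simp

theorem inv_left {w : Rˣ} (h : QComm D e w x) : QComm D (-e) ((w⁻¹ : Rˣ) : R) x := by
  unfold QComm at *
  have key : x * (w⁻¹ : Rˣ) = ((D.q ^ e : Rˣ) : R) * ((w⁻¹ : Rˣ) * x) := by
    calc x * (w⁻¹ : Rˣ) = (w⁻¹ : Rˣ) * (w * x) * (w⁻¹ : Rˣ) := by simp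
      _ = (((w⁻¹ : Rˣ) : R) * ((D.q ^ e : Rˣ) : R)) * (x * w) * (w⁻¹ : Rˣ) := by
        rw [h]; simp only [mul_assoc]
      _ = _ := by rw [← (commute_zpow D e _).eq]; simp [mul_assoc]
  rw [key, ← mul_assoc, ← Units.val_mul, ← zpow_add]
  simp

theorem of_t_below {p r : Fin m} (hr : r < p) (c j : Fin n) :
    QComm D (if c = j then -1 else 0) (D.t p c : R) (D.t r j) := by
  unfold QComm
  split_ifs with h
  · subst h
    rw [D.col_rel c hr, ← mul_assoc]
    simp
  · simpa using (D.mixed_rel hr (Ne.symm h)).symm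

theorem of_t_left (p : Fin m) {c j : Fin n} (h : c < j) :
    QComm D 1 (D.t p c : R) (D.t p j) := by
  simpa [QComm] using D.row_rel p h

theorem refl (x : R) : QComm D 0 x x := by simp [QComm]

end QComm

end QCommutation

section PathSums

variable {R : Type u} [Ring R] {m n : ℕ} {white : Fin m → Fin n → Bool}

/-- The position of a square when rows are read downwards, each from right to left. -/
def sqRank (r : Fin m) (c : Fin n) : ℕ := n * r + (n - 1 - c)

theorem sqRank_lt_iff {r p : Fin m} {c a : Fin n} :
    sqRank r c < sqRank p a ↔ r < p ∨ r = p ∧ a < c := by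
  have hc := c.2
  have ha := a.2
  unfold sqRank
  rcases lt_trichotomy r p with h | h | h
  · have : n * ((r : ℕ) + 1) ≤ n * p := Nat.mul_le_mul_left n h
    rw [mul_add] at this
    simp only [h, true_or, iff_true]
    omega
  · subst h
    simp only [lt_irrefl, false_or, true_and, Fin.lt_def]
    omega
  · have : n * ((p : ℕ) + 1) ≤ n * r := Nat.mul_le_mul_left n h
    rw [mul_add] at this
    simp only [h.not_gt, h.ne', false_and, or_self, iff_false]
    omega

theorem sqRank_inj {r p : Fin m} {c a : Fin n} (h : sqRank r c = sqRank p a) :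
    r = p ∧ c = a := by
  have h1 : ¬ sqRank r c < sqRank p a := by omega
  have h2 : ¬ sqRank p a < sqRank r c := by omega
  rw [sqRank_lt_iff] at h1 h2
  have hr : r = p := by
    rcases lt_trichotomy r p with h | h | h
    · tauto
    · exact h
    · tauto
  subst hr
  refine ⟨rfl, ?_⟩
  rcases lt_trichotomy c a with h | h | h
  · tauto
  · exact h
  · tauto

theorem sqRank_lt (r : Fin m) (c : Fin n) : sqRank r c < m * n := by
  have hc := c.2
  have : n * ((r : ℕ) + 1) ≤ n * m := Nat.mul_le_mul_left n r.2
  rw [mul_add] at this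
  unfold sqRank
  rw [mul_comm m n]
  omega

theorem pathWeight_cons_cons (D : QMData R m n) (x y : CVertex m n) (l : List (CVertex m n)) :
    pathWeight D (x :: y :: l) = wt D x y * pathWeight D (y :: l) := by
  simp [pathWeight, steps]

theorem pathWeight_singleton (D : QMData R m n) (x : CVertex m n) :
    pathWeight D [x] = 1 := by
  simp [pathWeight, steps]

theorem pathWeight_concat (D : QMData R m n) {w : CVertex m n} (x : CVertex m n)
    {l : List (CVertex m n)} (h : l.getLast? = some w) :
    pathWeight D (l ++ [x]) = pathWeight D l * wt D w x := by
  induction l with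
  | nil => simp at h
  | cons a l ih =>
    cases l with
    | nil =>
      obtain rfl : a = w := by simpa using h
      simp [pathWeight_cons_cons, pathWeight_singleton]
    | cons b l =>
      have h' : (b :: l).getLast? = some w := by simpa [List.getLast?_cons_cons] using h
      have := ih h'
      simp only [List.cons_append] at this ⊢
      rw [pathWeight_cons_cons, pathWeight_cons_cons, this, mul_assoc]

theorem isPathFrom_concat {u w x : CVertex m n} {l : List (CVertex m n)}
    (h : IsPathFrom white u w l) (e : CEdge white w x) : IsPathFrom white u x (l ++ [x]) := by
  obtain ⟨h1, h2, h3⟩ := h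
  refine ⟨?_, ?_, by simp⟩
  · refine List.isChain_append.2 ⟨h1, by simp, ?_⟩
    intro y hy z hz
    rw [h3] at hy
    simp at hy hz
    subst hy hz
    exact e
  · cases l with
    | nil => simp at h2
    | cons a l => simpa using h2

theorem isPathFrom_cases {u x : CVertex m n} {l : List (CVertex m n)}
    (h : IsPathFrom white u x l) :
    (l = [u] ∧ u = x) ∨
      ∃ w l', l = l' ++ [x] ∧ IsPathFrom white u w l' ∧ CEdge white w x := by
  obtain ⟨h1, h2, h3⟩ := h
  obtain rfl | ⟨l', y, rfl⟩ := List.eq_nil_or_concat l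
  · simp at h2
  · rw [List.concat_eq_append] at *
    obtain rfl : y = x := by simpa using h3
    rcases List.eq_nil_or_concat l' with rfl | ⟨l'', w, rfl⟩
    · left
      obtain rfl : y = u := by simpa using h2
      simp
    · right
      rw [List.concat_eq_append] at *
      have h1' := List.isChain_append.1 h1
      refine ⟨w, l'' ++ [w], rfl, ⟨h1'.1, ?_, by simp⟩, h1'.2.2 w (by simp) y (by simp)⟩
      cases l'' with
      | nil => simpa using h2
      | cons a l => simpa using h2

/-- The sum of the weights of the paths from `r_i` to a vertex. -/
noncomputable def pathSum (D : QMData R m n) (white : Fin m → Fin n → Bool) (i : Fin m)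
    (v : CVertex m n) : R :=
  ∑ᶠ l ∈ {l | IsPathFrom white (.row i) v l}, pathWeight D l

/-- A function on vertices which increases along the edges of the Cauchon graph. -/
def height : CVertex m n → ℕ
  | .row _ => 0
  | .sq r c => sqRank r c + 1
  | .col _ => m * n + 1

theorem height_lt {u v : CVertex m n} (e : CEdge white u v) : height u < height v := by
  cases e with
  | fromRow i k => simp [height]
  | toCol i j =>
    have := sqRank_lt i j
    simpa [height] using this
  | horiz i k j h => simpa [height] using sqRank_lt_iff.2 (.inr ⟨rfl, h⟩)
  | vert i i' j h => simpa [height] using sqRank_lt_iff.2 (.inl h)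

instance : Finite (CVertex m n) := by
  let f : CVertex m n → (Fin m × Fin n) ⊕ Fin m ⊕ Fin n := fun v =>
    match v with
    | .sq r c => .inl (r, c)
    | .row r => .inr (.inl r)
    | .col c => .inr (.inr c)
  refine Finite.of_injective f ?_
  intro x y h
  cases x <;> cases y <;> simp_all [f]

theorem finite_paths (i : Fin m) (v : CVertex m n) :
    {l | IsPathFrom white (.row i) v l}.Finite := by
  induction hN : height v using Nat.strong_induction_on generalizing v with
  | _ N ih =>
    refine Set.Finite.subset (s := {[CVertex.row i]} ∪ ⋃ u ∈ {u | CEdge white u v},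
      (fun l => l ++ [v]) '' {l | IsPathFrom white (.row i) u l}) ?_ ?_
    · refine (Set.finite_singleton _).union ((Set.toFinite _).biUnion ?_)
      intro u hu
      exact (ih _ (hN ▸ height_lt hu) u rfl).image _
    · intro l hl
      rcases isPathFrom_cases hl with ⟨h, -⟩ | ⟨w, l', rfl, h, e⟩
      · exact .inl h
      · refine .inr ?_
        simp only [Set.mem_iUnion]
        exact ⟨w, e, l', h, rfl⟩

theorem pathSum_eq_finsum (D : QMData R m n) (i : Fin m) {v : CVertex m n}
    (hv : CVertex.row i ≠ v) :
    pathSum D white i v = ∑ᶠ u ∈ {u | CEdge white u v}, pathSum D white i u * wt D u v := by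
  have hset : {l | IsPathFrom white (.row i) v l} = ⋃ u ∈ {u | CEdge white u v},
      (fun l => l ++ [v]) '' {l | IsPathFrom white (.row i) u l} := by
    ext l
    simp only [Set.mem_iUnion]
    constructor
    · intro hl
      rcases isPathFrom_cases hl with ⟨-, h⟩ | ⟨w, l', rfl, h, e⟩
      · exact absurd h hv
      · exact ⟨w, e, l', h, rfl⟩
    · rintro ⟨u, e, l', h, rfl⟩
      exact isPathFrom_concat h e
  unfold pathSum
  rw [hset, finsum_mem_biUnion]
  · refine finsum_mem_congr rfl fun u hu => ?_
    rw [finsum_mem_image fun a _ b _ h => List.append_left_injective _ h]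
    rw [finsum_mem_eq_finite_toFinset_sum _ (finite_paths i u),
      finsum_mem_eq_finite_toFinset_sum _ (finite_paths i u), Finset.sum_mul]
    refine Finset.sum_congr rfl fun l hl => ?_
    exact pathWeight_concat D v ((Set.Finite.mem_toFinset _).1 hl).2.2
  · intro u _ w _ huw
    refine Set.disjoint_left.2 ?_
    rintro _ ⟨l, hl, rfl⟩ ⟨l', hl', h⟩
    obtain rfl : l' = l := List.append_left_injective _ h
    exact huw (Option.some_injective _ (hl.2.2.symm.trans hl'.2.2))
  · exact Set.toFinite _
  · intro u _
    exact (finite_paths i u).image _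

theorem pathSum_row (D : QMData R m n) (i r : Fin m) :
    pathSum D white i (.row r) = if i = r then 1 else 0 := by
  split_ifs with h
  · subst h
    have : {l | IsPathFrom white (.row i) (.row i) l} = {[CVertex.row i]} := by
      ext l
      constructor
      · intro hl
        rcases isPathFrom_cases hl with ⟨h, -⟩ | ⟨w, l', rfl, h, e⟩
        · exact h
        · cases e
      · rintro rfl
        exact ⟨List.isChain_singleton _, rfl, rfl⟩
    rw [pathSum, this, finsum_mem_singleton, pathWeight_singleton]
  · rw [pathSum_eq_finsum D i (by simpa using h)]
    have : {u | CEdge white u (CVertex.row r : CVertex m n)} = ∅ := by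
      ext u
      simp only [Set.mem_ofPred_eq, Set.mem_empty_iff_false, iff_false]
      intro e
      cases e
    rw [this, finsum_mem_empty]

theorem pathMatrix_eq (D : QMData R m n) (i : Fin m) (j : Fin n) :
    pathMatrix D white i j = pathSum D white i (.col j) :=
  finsum_set_coe_eq_finsum_mem (f := pathWeight D) {l | IsPathFrom white (.row i) (.col j) l}

/-- `o` is the row of the nearest white square above `(p, a)`, if there is one. -/
def IsAbove (white : Fin m → Fin n → Bool) (p : Fin m) (a : Fin n) (o : Option (Fin m)) : Prop :=
  ∀ r, o = some r ↔ r < p ∧ white r a = true ∧ ∀ l, r < l → l < p → white l a = false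

/-- `o` is the column of the nearest white square to the right of `(p, a)`, if there is one. -/
def IsRight (white : Fin m → Fin n → Bool) (p : Fin m) (a : Fin n) (o : Option (Fin n)) : Prop :=
  ∀ c, o = some c ↔ a < c ∧ white p c = true ∧ ∀ j, a < j → j < c → white p j = false

theorem exists_option_iff {α : Type*} {P : α → Prop} (h : ∀ x y, P x → P y → x = y) :
    ∃ o : Option α, ∀ x, o = some x ↔ P x := by
  by_cases hP : ∃ x, P x
  · obtain ⟨x, hx⟩ := hP
    refine ⟨some x, fun y => ⟨?_, fun hy => congrArg some (h x y hx hy)⟩⟩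
    rintro ⟨⟩
    exact hx
  · push Not at hP
    exact ⟨none, fun x => by simp [hP x]⟩

theorem exists_isAbove (white : Fin m → Fin n → Bool) (p : Fin m) (a : Fin n) :
    ∃ o, IsAbove white p a o := by
  refine exists_option_iff ?_
  rintro x y ⟨hx, hx', hx''⟩ ⟨hy, hy', hy''⟩
  rcases lt_trichotomy x y with h | h | h
  · simp [hx'' y h hy] at hy'
  · exact h
  · simp [hy'' x h hx] at hx'

theorem exists_isRight (white : Fin m → Fin n → Bool) (p : Fin m) (a : Fin n) :
    ∃ o, IsRight white p a o := by
  refine exists_option_iff ?_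
  rintro x y ⟨hx, hx', hx''⟩ ⟨hy, hy', hy''⟩
  rcases lt_trichotomy x y with h | h | h
  · simp [hy'' x hx h] at hx'
  · exact h
  · simp [hx'' y hy h] at hy'

theorem IsRight.black_of_none {p : Fin m} {a : Fin n} (h : IsRight white p a none)
    (c : Fin n) (hc : a < c) : white p c = false := by
  induction c using WellFoundedLT.induction with
  | _ c ih =>
    by_contra hw
    have := (h c).2 ⟨hc, by simpa using hw, fun j hj hjc => ih j hjc hj⟩
    simp at this

theorem pathSum_sq (D : QMData R m n) (i : Fin m) {p : Fin m} {a : Fin n}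
    (hw : white p a = true) {o : Option (Fin m)} (ho : IsAbove white p a o)
    {o' : Option (Fin n)} (ho' : IsRight white p a o') :
    pathSum D white i (.sq p a) = o.elim 0 (fun r => pathSum D white i (.sq r a)) +
      o'.elim (if i = p then (D.t p a : R) else 0)
        (fun c => pathSum D white i (.sq p c) * (↑((D.t p c)⁻¹) * ↑(D.t p a))) := by
  have hset : {u | CEdge white u (.sq p a)} =
      {u | ∃ r, o = some r ∧ u = .sq r a} ∪
        {u | u = o'.elim (CVertex.row p) (fun c => .sq p c)} := by
    ext u
    simp only [Set.mem_ofPred_eq, Set.mem_union]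
    constructor
    · intro e
      cases e with
      | fromRow i k h1 h2 =>
        right
        cases o' with
        | none => rfl
        | some c =>
          obtain ⟨h3, h4, -⟩ := (ho' c).1 rfl
          simp [h2 c h3] at h4
      | horiz i k j h1 h2 h3 h4 =>
        right
        rw [(ho' k).2 ⟨h1, h2, h4⟩]
        rfl
      | vert i i' j h1 h2 h3 h4 => exact .inl ⟨i, (ho i).2 ⟨h1, h2, h4⟩, rfl⟩
    · rintro (⟨r, hr, rfl⟩ | rfl)
      · obtain ⟨h1, h2, h3⟩ := (ho r).1 hr
        exact .vert r p a h1 h2 hw h3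
      · cases o' with
        | none => exact .fromRow p a hw ho'.black_of_none
        | some c =>
          obtain ⟨h1, h2, h3⟩ := (ho' c).1 rfl
          exact .horiz p c a h1 h2 hw h3
  rw [pathSum_eq_finsum D i (by simp), hset, finsum_mem_union _ (Set.toFinite _) (Set.toFinite _)]
  · congr 1
    · cases o with
      | none => simp
      | some r =>
        have hr := ((ho r).1 rfl).1
        have : {u : CVertex m n | ∃ r', some r = some r' ∧ u = .sq r' a} = {.sq r a} := by
          ext u; simp
        rw [this, finsum_mem_singleton]
        simp [wt, hr.ne]
    · rw [Set.ofPred_eq_eq_singleton, finsum_mem_singleton]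
      cases o' with
      | none => simp [wt, pathSum_row]
      | some c =>
        have hc := ((ho' c).1 rfl).1
        simp [wt, hc]
  · refine Set.disjoint_left.2 ?_
    rintro _ ⟨r, hr, rfl⟩ h
    have hr := ((ho r).1 hr).1
    cases o' with
    | none => simp at h
    | some c => simp [hr.ne] at h

theorem pathSum_sq_of_gt (D : QMData R m n) {i p : Fin m} {a : Fin n} (hw : white p a = true)
    (hi : p < i) : pathSum D white i (.sq p a) = 0 := by
  induction hN : sqRank p a using Nat.strong_induction_on generalizing p a with
  | _ N ih =>
    obtain ⟨o, ho⟩ := exists_isAbove white p a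
    obtain ⟨o', ho'⟩ := exists_isRight white p a
    rw [pathSum_sq D i hw ho ho']
    have h1 : o.elim 0 (fun r => pathSum D white i (.sq r a)) = 0 := by
      cases o with
      | none => rfl
      | some r =>
        obtain ⟨h, h', -⟩ := (ho r).1 rfl
        exact ih _ (hN ▸ sqRank_lt_iff.2 (.inl h)) h' (h.trans hi) rfl
    rw [h1, zero_add]
    cases o' with
    | none => simp [hi.ne']
    | some c =>
      obtain ⟨h, h', -⟩ := (ho' c).1 rfl
      simp [ih _ (hN ▸ sqRank_lt_iff.2 (.inr ⟨rfl, h⟩)) h' hi rfl]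

theorem pathSum_sq_self (D : QMData R m n) {p : Fin m} {a : Fin n} (hw : white p a = true) :
    pathSum D white p (.sq p a) = D.t p a := by
  induction hN : sqRank p a using Nat.strong_induction_on generalizing a with
  | _ N ih =>
    obtain ⟨o, ho⟩ := exists_isAbove white p a
    obtain ⟨o', ho'⟩ := exists_isRight white p a
    rw [pathSum_sq D p hw ho ho']
    have h1 : o.elim 0 (fun r => pathSum D white p (.sq r a)) = 0 := by
      cases o with
      | none => rfl
      | some r =>
        obtain ⟨h, h', -⟩ := (ho r).1 rfl
        exact pathSum_sq_of_gt D h' h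
    rw [h1, zero_add]
    cases o' with
    | none => simp
    | some c =>
      obtain ⟨h, h', -⟩ := (ho' c).1 rfl
      simp [ih _ (hN ▸ sqRank_lt_iff.2 (.inr ⟨rfl, h⟩)) h' rfl]

theorem qcomm_pathSum_below (D : QMData R m n) {p : Fin m} (c : Fin n) (i : Fin m)
    {r : Fin m} {j : Fin n} (hw : white r j = true) (hr : r < p) :
    QComm D (if c = j then -1 else 0) (D.t p c : R) (pathSum D white i (.sq r j)) := by
  induction hN : sqRank r j using Nat.strong_induction_on generalizing r j with
  | _ N ih =>
    obtain ⟨o, ho⟩ := exists_isAbove white r j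
    obtain ⟨o', ho'⟩ := exists_isRight white r j
    rw [pathSum_sq D i hw ho ho']
    refine QComm.add ?_ ?_
    · cases o with
      | none => exact .zero_right
      | some r' =>
        obtain ⟨h, h', -⟩ := (ho r').1 rfl
        exact ih _ (hN ▸ sqRank_lt_iff.2 (.inl h)) h' (h.trans hr) rfl
    · cases o' with
      | none =>
        simp only [Option.elim_none]
        split_ifs
        all_goals first | exact .zero_right | skip
        all_goals simpa [*] using QComm.of_t_below (D := D) hr c j
      | some d =>
        obtain ⟨h, h', -⟩ := (ho' d).1 rfl
        have h1 := ih _ (hN ▸ sqRank_lt_iff.2 (.inr ⟨rfl, h⟩)) h' hr rfl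
        have h2 := h1.mul_right (((QComm.of_t_below hr c d).inv_right).mul_right
          (QComm.of_t_below hr c j))
        simpa using h2

theorem qcomm_pathSum_left (D : QMData R m n) {p : Fin m} {c : Fin n} {i : Fin m}
    {j : Fin n} (hw : white p j = true) (hi : i < p) (hc : c ≤ j) :
    QComm D (if c = j then -1 else 0) (D.t p c : R) (pathSum D white i (.sq p j)) := by
  induction hN : sqRank p j using Nat.strong_induction_on generalizing j with
  | _ N ih =>
    obtain ⟨o, ho⟩ := exists_isAbove white p j
    obtain ⟨o', ho'⟩ := exists_isRight white p j
    rw [pathSum_sq D i hw ho ho']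
    refine QComm.add ?_ ?_
    · cases o with
      | none => exact .zero_right
      | some r' =>
        obtain ⟨h, h', -⟩ := (ho r').1 rfl
        exact qcomm_pathSum_below D c i h' h
    · cases o' with
      | none =>
        simp only [Option.elim_none, hi.ne, if_false]
        exact .zero_right
      | some d =>
        obtain ⟨h, h', -⟩ := (ho' d).1 rfl
        have h1 := ih _ (hN ▸ sqRank_lt_iff.2 (.inr ⟨rfl, h⟩)) h' (hc.trans h.le) rfl
        rw [if_neg (hc.trans_lt h).ne] at h1
        have h2 := (QComm.of_t_left (D := D) p (hc.trans_lt h)).inv_right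
        rcases hc.eq_or_lt with rfl | hlt
        · simpa using h1.mul_right (h2.mul_right (QComm.refl _))
        · simpa [hlt.ne] using h1.mul_right (h2.mul_right (QComm.of_t_left p hlt))

end PathSums
section QDet

variable {R : Type u} [Ring R] {m n : ℕ}

theorem qdet_eq_zero_of_row {k : ℕ} (q : Rˣ) {N : Matrix (Fin k) (Fin k) R} (l : Fin k)
    (h : ∀ c, N l c = 0) : qdet q N = 0 := by
  refine Finset.sum_eq_zero fun σ _ => ?_
  rw [List.prod_eq_zero, mul_zero]
  exact List.mem_map.2 ⟨l, List.mem_finRange l, h _⟩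

theorem qdet_eq_zero_of_col {k : ℕ} (q : Rˣ) {N : Matrix (Fin k) (Fin k) R} (c : Fin k)
    (h : ∀ l, N l c = 0) : qdet q N = 0 := by
  refine Finset.sum_eq_zero fun σ _ => ?_
  rw [List.prod_eq_zero, mul_zero]
  exact List.mem_map.2 ⟨σ.symm c, List.mem_finRange _, by simp [h]⟩

theorem prod_ofFn_add {k : ℕ} {f g h : Fin k → R} (p : Fin k) (hp : h p = f p + g p)
    (hf : ∀ i, i ≠ p → f i = h i) (hg : ∀ i, i ≠ p → g i = h i) :
    (List.ofFn h).prod = (List.ofFn f).prod + (List.ofFn g).prod := by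
  induction k with
  | zero => exact p.elim0
  | succ k ih =>
    simp only [List.ofFn_succ, List.prod_cons]
    cases p using Fin.cases with
    | zero =>
      rw [hp, add_mul]
      simp only [hf _ (Fin.succ_ne_zero _), hg _ (Fin.succ_ne_zero _)]
    | succ p =>
      rw [hf 0 (Fin.succ_ne_zero p).symm, hg 0 (Fin.succ_ne_zero p).symm, ← mul_add]
      congr 1
      exact ih p hp (fun i hi => hf _ (by simpa using hi)) fun i hi => hg _ (by simpa using hi)

theorem qdet_add_col {k : ℕ} (q : Rˣ) {N A B : Matrix (Fin k) (Fin k) R} (b : Fin k)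
    (hb : ∀ l, N l b = A l b + B l b) (hA : ∀ l c, c ≠ b → A l c = N l c)
    (hB : ∀ l c, c ≠ b → B l c = N l c) : qdet q N = qdet q A + qdet q B := by
  unfold qdet
  rw [← Finset.sum_add_distrib]
  refine Finset.sum_congr rfl fun σ _ => ?_
  rw [← mul_add]
  congr 1
  simp only [← List.ofFn_eq_map]
  refine prod_ofFn_add (σ.symm b) (by simpa using hb _) ?_ ?_
  · intro i hi
    exact hA _ _ fun h => hi (by simp [← h])
  · intro i hi
    exact hB _ _ fun h => hi (by simp [← h])

theorem qcomm_prod_ofFn (D : QMData R m n) {k : ℕ} {f : Fin k → R} {e : Fin k → ℤ} {u : R}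
    (h : ∀ i, QComm D (e i) u (f i)) : QComm D (∑ i, e i) u (List.ofFn f).prod := by
  induction k with
  | zero => simp [QComm]
  | succ k ih =>
    rw [List.ofFn_succ, List.prod_cons, Fin.sum_univ_succ]
    exact (h 0).mul_right (ih fun i => h i.succ)

theorem prod_ofFn_mul_unit (D : QMData R m n) {k : ℕ} {f g : Fin k → R} {e : Fin k → ℤ} {u : R}
    (p : Fin k) (hp : g p = f p * u) (hg : ∀ i, i ≠ p → g i = f i)
    (h : ∀ i, i ≠ p → QComm D (e i) u (f i)) :
    (List.ofFn g).prod =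
      ((D.q ^ (∑ i, if p < i then e i else 0) : Rˣ) : R) * ((List.ofFn f).prod * u) := by
  induction k with
  | zero => exact p.elim0
  | succ k ih =>
    simp only [List.ofFn_succ, List.prod_cons, Fin.sum_univ_succ]
    cases p using Fin.cases with
    | zero =>
      have := qcomm_prod_ofFn D (f := fun i : Fin k => f i.succ) (e := fun i => e i.succ) (u := u)
        fun i => h i.succ (Fin.succ_ne_zero i)
      simp only [hg _ (Fin.succ_ne_zero _), Fin.succ_pos, if_true, lt_irrefl, if_false, zero_add]
      rw [hp, mul_assoc, this, (commute_zpow D _ (f 0)).symm.left_comm]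
      simp only [mul_assoc]
    | succ p =>
      have := ih (f := fun i => f i.succ) (g := fun i => g i.succ) (e := fun i => e i.succ) p hp
        (fun i hi => hg _ (by simpa using hi)) fun i hi => h _ (by simpa using hi)
      rw [this, hg 0 (Fin.succ_ne_zero p).symm, (commute_zpow D _ (f 0)).symm.left_comm]
      simp only [Fin.succ_lt_succ_iff, Fin.not_lt_zero, if_false, zero_add, mul_assoc]

theorem qdet_mul_col (D : QMData R m n) {k : ℕ} {N A : Matrix (Fin k) (Fin k) R} {u : R}
    (b : Fin k) (hb : ∀ l, N l b = A l b * u) (hA : ∀ l c, c ≠ b → A l c = N l c)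
    (hu : ∀ l c, c ≠ b → QComm D 0 u (A l c)) : qdet D.q N = qdet D.q A * u := by
  unfold qdet
  rw [Finset.sum_mul]
  refine Finset.sum_congr rfl fun σ _ => ?_
  simp only [← List.ofFn_eq_map]
  rw [prod_ofFn_mul_unit D (f := fun i => A i (σ i)) (u := u) (e := fun _ => 0) (σ.symm b)]
  · simp [mul_assoc]
  · simpa using hb _
  · intro i hi
    exact (hA _ _ fun h => hi (by simp [← h])).symm
  · intro i hi
    exact hu _ _ fun h => hi (by simp [← h])

theorem swap_lt_swap_iff {k : ℕ} {b b' x y : Fin k} (hbb : (b' : ℕ) = b + 1)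
    (h : ¬(x = b ∧ y = b')) (h' : ¬(x = b' ∧ y = b)) :
    Equiv.swap b b' x < Equiv.swap b b' y ↔ x < y := by
  simp only [Equiv.swap_apply_def, Fin.lt_def, Fin.ext_iff] at *
  split_ifs <;> omega

theorem invCount_swap_mul {k : ℕ} {b b' : Fin k} (hbb : (b' : ℕ) = b + 1)
    (σ : Equiv.Perm (Fin k)) (h : σ.symm b < σ.symm b') :
    invCount (Equiv.swap b b' * σ) = invCount σ + 1 := by
  have hlt : b < b' := by rw [Fin.lt_def]; omega
  unfold invCount
  rw [← Finset.card_insert_of_notMem (a := (σ.symm b, σ.symm b'))]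
  · congr 1
    ext ⟨i, j⟩
    rw [Finset.mem_insert, Finset.mem_filter, Finset.mem_filter]
    simp only [Finset.mem_univ, true_and, Prod.mk.injEq, Equiv.Perm.mul_apply]
    by_cases h1 : i = σ.symm b ∧ j = σ.symm b'
    · simp [h1.1, h1.2, h, hlt]
    · simp only [h1, false_or]
      refine and_congr_right fun hij => ?_
      refine swap_lt_swap_iff hbb ?_ ?_
      · rintro ⟨h2, h3⟩
        rw [← h2, ← h3] at h
        simp at h
        exact absurd h hij.not_gt
      · rintro ⟨h2, h3⟩
        exact h1 (by simp [← h2, ← h3])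
  · simp [hlt.le]

theorem qdet_eq_zero_of_adjacent (D : QMData R m n) {k : ℕ} {N : Matrix (Fin k) (Fin k) R}
    {u : R} {b b' : Fin k} (hbb : (b' : ℕ) = b + 1) (hb : ∀ l, N l b = N l b' * u)
    (hu : ∀ l c, c ≠ b → QComm D (if c = b' then 1 else 0) u (N l c)) : qdet D.q N = 0 := by
  have hne : b ≠ b' := by rw [Ne, Fin.ext_iff]; omega
  set X : Equiv.Perm (Fin k) → R := fun σ =>
    (List.ofFn fun i => N i (if σ i = b then b' else σ i)).prod * u with hX
  have hterm : ∀ σ : Equiv.Perm (Fin k), (List.ofFn fun i => N i (σ i)).prod =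
      (if σ.symm b < σ.symm b' then (D.q : R) else 1) * X σ := by
    intro σ
    rw [prod_ofFn_mul_unit D (f := fun i => N i (if σ i = b then b' else σ i)) (u := u)
      (e := fun i => if i = σ.symm b' then 1 else 0) (σ.symm b)]
    · have : (∑ i, if σ.symm b < i then (if i = σ.symm b' then (1 : ℤ) else 0) else 0) =
          if σ.symm b < σ.symm b' then 1 else 0 := by
        rw [Finset.sum_eq_single (σ.symm b')]
        · simp
        · intro i _ hi
          simp [hi]
        · simp
      rw [this]
      split_ifs <;> simp [hX]
    · simpa using hb _
    · intro i hi
      have : σ i ≠ b := fun h => hi (by simp [← h])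
      simp [this]
    · intro i hi
      have : σ i ≠ b := fun h => hi (by simp [← h])
      have h2 := hu i (σ i) this
      simp only [this, if_false]
      simpa [Equiv.eq_symm_apply] using h2
  have hXswap : ∀ σ : Equiv.Perm (Fin k), X (Equiv.swap b b' * σ) = X σ := by
    intro σ
    simp only [hX]
    congr 3
    funext i
    congr 1
    simp only [Equiv.Perm.mul_apply, Equiv.swap_apply_def]
    split_ifs <;> simp_all
  have hpair : ∀ σ : Equiv.Perm (Fin k), σ.symm b < σ.symm b' →
      (-(D.q : R)) ^ invCount σ * ((List.finRange k).map fun i => N i (σ i)).prod +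
      (-(D.q : R)) ^ invCount (Equiv.swap b b' * σ) *
        ((List.finRange k).map fun i => N i ((Equiv.swap b b' * σ) i)).prod = 0 := by
    intro σ h
    have h' : ¬ (Equiv.swap b b' * σ).symm b < (Equiv.swap b b' * σ).symm b' := by
      rw [← Equiv.Perm.inv_def, mul_inv_rev]
      simpa using h.le
    simp only [← List.ofFn_eq_map]
    rw [hterm, hterm, if_pos h, if_neg h', hXswap, invCount_swap_mul hbb σ h, pow_succ]
    simp [mul_assoc]
  unfold qdet
  refine Finset.sum_involution (fun σ _ => Equiv.swap b b' * σ) ?_ ?_ (fun _ _ => Finset.mem_univ _)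
    ?_
  · intro σ _
    by_cases h : σ.symm b < σ.symm b'
    · exact hpair σ h
    · have h2 : (Equiv.swap b b' * σ).symm b < (Equiv.swap b b' * σ).symm b' := by
        rw [← Equiv.Perm.inv_def, mul_inv_rev]
        refine lt_of_le_of_ne (by simpa using h) ?_
        simpa using hne.symm
      have := hpair _ h2
      rw [Equiv.swap_mul_self_mul] at this
      rw [add_comm]
      exact this
  · intro σ _ _ h
    have : Equiv.swap b b' = 1 := mul_eq_right.1 h
    exact hne (Equiv.swap_eq_one_iff.1 this)
  · intro σ _
    exact Equiv.swap_mul_self_mul b b' σ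

/-- The permutation sending the last index to `b` and acting as `τ` on the remaining ones. -/
def extendPerm {k : ℕ} (b : Fin (k + 1)) (τ : Equiv.Perm (Fin k)) : Equiv.Perm (Fin (k + 1)) :=
  (finSuccEquiv' (Fin.last k)).trans (τ.optionCongr.trans (finSuccEquiv' b).symm)

theorem extendPerm_last {k : ℕ} (b : Fin (k + 1)) (τ : Equiv.Perm (Fin k)) :
    extendPerm b τ (Fin.last k) = b := by
  simp [extendPerm]

theorem extendPerm_castSucc {k : ℕ} (b : Fin (k + 1)) (τ : Equiv.Perm (Fin k)) (i : Fin k) :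
    extendPerm b τ i.castSucc = b.succAbove (τ i) := by
  have : finSuccEquiv' (Fin.last k) i.castSucc = some i := by
    rw [← Fin.succAbove_last_apply]
    exact finSuccEquiv'_succAbove _ _
  simp [extendPerm, this]

theorem extendPerm_injective {k : ℕ} (b : Fin (k + 1)) : Function.Injective (extendPerm b) := by
  intro τ τ' h
  ext i
  have := congrArg (fun σ => σ i.castSucc) h
  simp only [extendPerm_castSucc] at this
  rw [Fin.succAbove_right_injective this]

theorem mem_range_extendPerm {k : ℕ} {b : Fin (k + 1)} {σ : Equiv.Perm (Fin (k + 1))}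
    (h : σ (Fin.last k) = b) : σ ∈ Set.range (extendPerm b) := by
  have hne : ∀ i : Fin k, σ i.castSucc ≠ b := fun i hi =>
    (Fin.castSucc_lt_last i).ne (σ.injective (hi.trans h.symm))
  choose f hf using fun i => Fin.exists_succAbove_eq (hne i)
  have hinj : Function.Injective f := by
    intro i j hij
    have : σ i.castSucc = σ j.castSucc := by rw [← hf, ← hf, hij]
    exact Fin.castSucc_injective _ (σ.injective this)
  refine ⟨Equiv.ofBijective f (Finite.injective_iff_bijective.1 hinj), ?_⟩
  ext i
  cases i using Fin.lastCases with
  | last => rw [extendPerm_last, h]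
  | cast i => rw [extendPerm_castSucc, ← hf i]; rfl

theorem invCount_extendPerm {k : ℕ} (b : Fin (k + 1)) (τ : Equiv.Perm (Fin k)) :
    invCount (extendPerm b τ) =
      invCount τ + (Finset.univ.filter fun y : Fin k => b < b.succAbove y).card := by
  unfold invCount
  have h1 : (Finset.univ.filter fun y : Fin k => b < b.succAbove y).card =
      (Finset.univ.filter fun y : Fin k => b < b.succAbove (τ y)).card := by
    simp only [← Fintype.card_subtype]
    exact (Fintype.card_congr (τ.subtypeEquiv fun _ => Iff.rfl)).symm
  have h2 : ((Finset.univ : Finset (Fin (k + 1) × Fin (k + 1))).filter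
      fun p => p.1 < p.2 ∧ extendPerm b τ p.2 < extendPerm b τ p.1) =
      (((Finset.univ : Finset (Fin k × Fin k)).filter fun p => p.1 < p.2 ∧ τ p.2 < τ p.1).map
        (Fin.castSuccEmb.prodMap Fin.castSuccEmb)) ∪
      ((Finset.univ.filter fun y : Fin k => b < b.succAbove (τ y)).map
        (Fin.castSuccEmb.trans (Function.Embedding.sectL (Fin (k + 1)) (Fin.last k)))) := by
    ext ⟨i, j⟩
    simp only [Finset.mem_filter, Finset.mem_univ, true_and, Finset.mem_union, Finset.mem_map,
      Prod.exists, Function.Embedding.trans_apply, Function.Embedding.sectL_apply,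
      Function.Embedding.coe_prodMap, Prod.map_apply,
      Prod.mk.injEq]
    cases i using Fin.lastCases with
    | last =>
      simp [(Fin.le_last j).not_gt, (Fin.castSucc_lt_last _).ne]
    | cast i =>
      cases j using Fin.lastCases with
      | last => simp [extendPerm_last, extendPerm_castSucc, (Fin.castSucc_lt_last _).ne,
          Fin.castSucc_lt_last]
      | cast j => simp [extendPerm_castSucc, (Fin.castSucc_lt_last _).ne']
  rw [h2, h1, Finset.card_union_of_disjoint, Finset.card_map, Finset.card_map]
  refine Finset.disjoint_left.2 ?_
  rintro ⟨i, j⟩ hp hp'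
  obtain ⟨⟨x, y⟩, -, h⟩ := Finset.mem_map.1 hp
  obtain ⟨z, -, h'⟩ := Finset.mem_map.1 hp'
  have := congrArg Prod.snd (h.trans h'.symm)
  exact (Fin.castSucc_lt_last y).ne this

theorem qdet_eq_zero_of_minor {k : ℕ} (q : Rˣ) {N : Matrix (Fin (k + 1)) (Fin (k + 1)) R}
    (b : Fin (k + 1)) (hb : ∀ l : Fin k, N l.castSucc b = 0)
    (h : qdet q (Matrix.of fun l c : Fin k => N l.castSucc (b.succAbove c)) = 0) :
    qdet q N = 0 := by
  set d := (Finset.univ.filter fun y : Fin k => b < b.succAbove y).card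
  suffices qdet q N = (-(q : R)) ^ d *
      qdet q (Matrix.of fun l c : Fin k => N l.castSucc (b.succAbove c)) * N (Fin.last k) b by
    rw [this, h, mul_zero, zero_mul]
  unfold qdet
  rw [Finset.mul_sum, Finset.sum_mul]
  symm
  refine Fintype.sum_of_injective (extendPerm b) (extendPerm_injective b) _ _ ?_ ?_
  · intro σ hσ
    have hlast : σ.symm b ≠ Fin.last k := fun h' => hσ (mem_range_extendPerm (by simp [← h']))
    obtain ⟨l, hl⟩ := Fin.exists_castSucc_eq.2 hlast
    rw [List.prod_eq_zero, mul_zero]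
    refine List.mem_map.2 ⟨σ.symm b, List.mem_finRange _, ?_⟩
    rw [Equiv.apply_symm_apply, ← hl, hb]
  · intro τ
    simp only [← List.ofFn_eq_map]
    rw [invCount_extendPerm, List.ofFn_succ_last, add_comm, pow_add]
    simp [extendPerm_last, extendPerm_castSucc, mul_assoc]
    rfl

end QDet

section Cuts

variable {R : Type u} [Ring R] {m n : ℕ} {white : Fin m → Fin n → Bool}

/-- `v j` is the row of the lowest white square of column `j` among the first `s` squares. -/
def IsCut (white : Fin m → Fin n → Bool) (s : ℕ) (v : Fin n → Option (Fin m)) : Prop :=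
  ∀ j r, v j = some r ↔ white r j = true ∧ sqRank r j < s ∧
    ∀ r', r < r' → sqRank r' j < s → white r' j = false

/-- The sum of the weights of the paths from `r_i` to the square of a cut in column `j`. -/
noncomputable def cutSum (D : QMData R m n) (white : Fin m → Fin n → Bool)
    (v : Fin n → Option (Fin m)) (i : Fin m) (j : Fin n) : R :=
  (v j).elim 0 fun r => pathSum D white i (.sq r j)

/-- The vertices available to path systems from the rows `ι` inside the first `s` squares. -/
def Available (s : ℕ) {k : ℕ} (ι : Fin k → Fin m) : CVertex m n → Prop
  | .sq r c => sqRank r c < s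
  | .row i => i ∈ Set.range ι
  | .col _ => False

/-- There is a vertex-disjoint path system from the rows `ι` to the vertices `T` inside the
first `s` squares. -/
def Linked (white : Fin m → Fin n → Bool) (s : ℕ) {k : ℕ} (ι : Fin k → Fin m)
    (T : Fin k → CVertex m n) : Prop :=
  ∃ (σ : Equiv.Perm (Fin k)) (P : Fin k → List (CVertex m n)),
    (∀ l, IsPathFrom white (.row (ι l)) (T (σ l)) (P l)) ∧
    (∀ a b, a ≠ b → ∀ x, x ∈ P a → x ∉ P b) ∧ ∀ l, ∀ x ∈ P l, Available s ι x

theorem Available.mono {s s' : ℕ} (hs : s ≤ s') {k : ℕ} {ι : Fin k → Fin m} {x : CVertex m n}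
    (h : Available s ι x) : Available s' ι x := by
  cases x with
  | sq r c => exact lt_of_lt_of_le h hs
  | row i => exact h
  | col c => exact h

theorem Linked.mono {s s' : ℕ} (hs : s ≤ s') {k : ℕ} {ι : Fin k → Fin m}
    {T : Fin k → CVertex m n} (h : Linked white s ι T) : Linked white s' ι T := by
  obtain ⟨σ, P, h1, h2, h3⟩ := h
  exact ⟨σ, P, h1, h2, fun l x hx => (h3 l x hx).mono hs⟩

theorem Linked.extend {k : ℕ} {ι : Fin k → Fin m} {T : Fin k → CVertex m n} {b : Fin k}
    {p : Fin m} {a : Fin n} (h : Linked white (sqRank p a) ι T)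
    (e : CEdge white (T b) (.sq p a)) :
    Linked white (sqRank p a + 1) ι (Function.update T b (.sq p a)) := by
  obtain ⟨σ, P, h1, h2, h3⟩ := h
  have hfresh : ∀ l, CVertex.sq p a ∉ P l := fun l hl => lt_irrefl _ (h3 l _ hl)
  refine ⟨σ, Function.update P (σ.symm b) (P (σ.symm b) ++ [.sq p a]), ?_, ?_, ?_⟩
  · intro l
    by_cases hl : l = σ.symm b
    · subst hl
      simp only [Function.update_self, Equiv.apply_symm_apply]
      refine isPathFrom_concat (w := T b) ?_ e
      simpa using h1 (σ.symm b)
    · have : σ l ≠ b := fun h => hl (by simp [← h])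
      simpa [Function.update_of_ne, hl, this] using h1 l
  · intro c d hcd x hx hy
    by_cases hc : c = σ.symm b
    · have hd : d ≠ σ.symm b := fun h => hcd (hc.trans h.symm)
      subst hc
      simp only [Function.update_self, List.mem_append, List.mem_singleton] at hx
      rw [Function.update_of_ne hd] at hy
      rcases hx with hx | rfl
      · exact h2 _ _ hcd x hx hy
      · exact hfresh _ hy
    · rw [Function.update_of_ne hc] at hx
      by_cases hd : d = σ.symm b
      · subst hd
        simp only [Function.update_self, List.mem_append, List.mem_singleton] at hy
        rcases hy with hy | rfl
        · exact h2 _ _ hcd x hx hy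
        · exact hfresh _ hx
      · rw [Function.update_of_ne hd] at hy
        exact h2 _ _ hcd x hx hy
  · intro l x hx
    by_cases hl : l = σ.symm b
    · subst hl
      simp only [Function.update_self, List.mem_append, List.mem_singleton] at hx
      rcases hx with hx | rfl
      · exact (h3 _ x hx).mono (Nat.le_succ _)
      · exact Nat.lt_succ_self _
    · rw [Function.update_of_ne hl] at hx
      exact (h3 _ x hx).mono (Nat.le_succ _)

theorem Linked.add_row {k : ℕ} {ι : Fin (k + 1) → Fin m} (hι : StrictMono ι)
    {T : Fin k → CVertex m n} {T' : Fin (k + 1) → CVertex m n} {b : Fin (k + 1)}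
    {a : Fin n} (h : Linked white (sqRank (ι (Fin.last k)) a) (fun l => ι l.castSucc) T)
    (e : CEdge white (.row (ι (Fin.last k))) (.sq (ι (Fin.last k)) a))
    (hb : T' b = .sq (ι (Fin.last k)) a) (hT : ∀ c, T' (b.succAbove c) = T c) :
    Linked white (sqRank (ι (Fin.last k)) a + 1) ι T' := by
  obtain ⟨σ, P, h1, h2, h3⟩ := h
  set p := ι (Fin.last k) with hp
  have hfresh : ∀ l, ∀ x ∈ [CVertex.row p, .sq p a], x ∉ P l := by
    intro l x hx hl
    have := h3 l x hl
    simp only [List.mem_cons, List.not_mem_nil, or_false] at hx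
    rcases hx with rfl | rfl
    · obtain ⟨y, hy⟩ := this
      exact (Fin.castSucc_lt_last y).ne (hι.injective hy)
    · exact lt_irrefl _ this
  refine ⟨extendPerm b σ, Fin.snoc (α := fun _ => List (CVertex m n)) P [.row p, .sq p a],
    ?_, ?_, ?_⟩
  · intro l
    cases l using Fin.lastCases with
    | last =>
      rw [extendPerm_last, hb, Fin.snoc_last]
      exact ⟨List.isChain_pair.2 e, rfl, rfl⟩
    | cast l =>
      rw [extendPerm_castSucc, hT, Fin.snoc_castSucc]
      exact h1 l
  · intro c d hcd x hx hy
    cases c using Fin.lastCases with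
    | last =>
      cases d using Fin.lastCases with
      | last => exact hcd rfl
      | cast d =>
        rw [Fin.snoc_last] at hx
        rw [Fin.snoc_castSucc] at hy
        exact hfresh d x hx hy
    | cast c =>
      rw [Fin.snoc_castSucc] at hx
      cases d using Fin.lastCases with
      | last =>
        rw [Fin.snoc_last] at hy
        exact hfresh c x hy hx
      | cast d =>
        rw [Fin.snoc_castSucc] at hy
        exact h2 c d (fun h => hcd (by rw [h])) x hx hy
  · intro l x hx
    cases l using Fin.lastCases with
    | last =>
      rw [Fin.snoc_last] at hx
      simp only [List.mem_cons, List.not_mem_nil, or_false] at hx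
      rcases hx with rfl | rfl
      · exact ⟨Fin.last k, rfl⟩
      · exact Nat.lt_succ_self _
    | cast l =>
      rw [Fin.snoc_castSucc] at hx
      have := h3 l x hx
      cases x with
      | sq r c => exact lt_trans this (Nat.lt_succ_self _)
      | row i =>
        obtain ⟨y, hy⟩ := this
        exact ⟨y.castSucc, hy⟩
      | col c => exact this

/-- Non-vanishing quantum minors of the path sums of a cut come from vertex-disjoint path
systems. -/
def MinorsLinked (D : QMData R m n) (white : Fin m → Fin n → Bool) (s : ℕ)
    (v : Fin n → Option (Fin m)) : Prop :=
  ∀ ⦃k : ℕ⦄ ⦃ι : Fin k → Fin m⦄ ⦃κ : Fin k → Fin n⦄, StrictMono ι → StrictMono κ →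
    qdet D.q (Matrix.of fun l c => cutSum D white v (ι l) (κ c)) ≠ 0 →
    ∃ T : Fin k → CVertex m n, (∀ c, ∃ r, v (κ c) = some r ∧ T c = .sq r (κ c)) ∧
      Linked white s ι T

namespace IsCut

variable {p : Fin m} {a : Fin n} {v : Fin n → Option (Fin m)}

theorem isAbove (hv : IsCut white (sqRank p a) v) : IsAbove white p a (v a) := by
  intro r
  rw [hv a r]
  simp only [sqRank_lt_iff, lt_irrefl, and_false, or_false]
  tauto

theorem eq_some_of_right (hv : IsCut white (sqRank p a) v) {c : Fin n} (hc : a < c)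
    (hw : white p c = true) : v c = some p := by
  rw [hv c p]
  refine ⟨hw, sqRank_lt_iff.2 (.inr ⟨rfl, hc⟩), fun r hr hr' => ?_⟩
  rcases sqRank_lt_iff.1 hr' with h | ⟨h, -⟩
  · exact absurd h hr.not_gt
  · exact absurd h hr.ne'

theorem eq_none_of_black (hC : IsCauchon white) (hw : white p a = true)
    (hv : IsCut white (sqRank p a) v) {c : Fin n} (hc : a < c) (hb : white p c = false) :
    v c = none := by
  rw [Option.eq_none_iff_forall_ne_some]
  intro r hr
  obtain ⟨h1, h2, -⟩ := (hv c r).1 hr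
  rcases hC p c hb with h | h
  · rcases sqRank_lt_iff.1 h2 with h3 | ⟨h3, -⟩
    · simp [h r h3] at h1
    · simp [h3, hb] at h1
  · simp [h a hc] at hw

theorem update (hw : white p a = true) (hv : IsCut white (sqRank p a) v) :
    IsCut white (sqRank p a + 1) (Function.update v a (some p)) := by
  intro j r
  by_cases hj : j = a
  · subst hj
    simp only [Function.update_self, Option.some.injEq, Nat.lt_succ_iff]
    constructor
    · rintro rfl
      exact ⟨hw, le_rfl, fun r hr hr' => absurd (sqRank_lt_iff.2 (.inl hr)) hr'.not_gt⟩
    · rintro ⟨h1, h2, h3⟩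
      rcases lt_trichotomy r p with h | h | h
      · simp [h3 p h le_rfl] at hw
      · exact h.symm
      · exact absurd (sqRank_lt_iff.2 (.inl h)) h2.not_gt
  · have key : ∀ r : Fin m, sqRank r j < sqRank p a + 1 ↔ sqRank r j < sqRank p a := by
      intro r
      have : sqRank r j ≠ sqRank p a := fun h => hj (sqRank_inj h).2
      omega
    simp only [Function.update_of_ne hj, key]
    exact hv j r

theorem qcomm_cutSum (D : QMData R m n)
    (hv : IsCut white (sqRank p a) v) {d : Fin n} (hd : a < d) (hwd : white p d = true)
    (hbd : ∀ j, a < j → j < d → white p j = false) (i : Fin m) {j : Fin n} (hj : j ≠ a) :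
    QComm D (if j = d then 1 else 0) (↑((D.t p d)⁻¹) * ↑(D.t p a) : R)
      (cutSum D white v i j) := by
  unfold cutSum
  cases hvj : v j with
  | none => exact .zero_right
  | some r =>
    obtain ⟨h1, h2, -⟩ := (hv j r).1 hvj
    simp only [Option.elim_some]
    rcases lt_or_ge r p with hr | hr
    · have hjd : j ≠ d := by
        rintro rfl
        rw [hv.eq_some_of_right hd hwd, Option.some.injEq] at hvj
        exact hr.ne' hvj
      have := (qcomm_pathSum_below D d i h1 hr).inv_left.mul_left (qcomm_pathSum_below D a i h1 hr)
      simpa [hjd, hj.symm, hjd.symm] using this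
    · obtain ⟨rfl, haj⟩ : r = p ∧ a < j := by
        rcases sqRank_lt_iff.1 h2 with h | h
        · exact absurd h hr.not_gt
        · exact h
      have hdj : d ≤ j := by
        by_contra h
        simp [hbd j haj (not_le.1 h)] at h1
      rcases lt_trichotomy i r with hi | rfl | hi
      · have := (qcomm_pathSum_left D h1 hi hdj).inv_left.mul_left
          (qcomm_pathSum_left D h1 hi haj.le)
        rw [if_neg hj.symm] at this
        rcases hdj.eq_or_lt with rfl | hlt
        · simpa using this
        · simpa [hlt.ne, hlt.ne'] using this
      · rw [pathSum_sq_self D h1]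
        have h3 := QComm.of_t_left (D := D) i haj
        rcases hdj.eq_or_lt with rfl | hlt
        · simpa using (QComm.refl (D := D) (D.t i d : R)).inv_left.mul_left h3
        · simpa [hlt.ne'] using (QComm.of_t_left (D := D) i hlt).inv_left.mul_left h3
      · rw [pathSum_sq_of_gt D h1 hi]
        exact .zero_right

end IsCut

theorem MinorsLinked.update (D : QMData R m n) (hC : IsCauchon white) {p : Fin m} {a : Fin n}
    {v : Fin n → Option (Fin m)} (hw : white p a = true) (hv : IsCut white (sqRank p a) v)
    (ih : MinorsLinked D white (sqRank p a) v) :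
    MinorsLinked D white (sqRank p a + 1) (Function.update v a (some p)) := by
  intro k ι κ hι hκ hq
  set v' := Function.update v a (some p) with hv'
  have hne : ∀ i j, j ≠ a → cutSum D white v' i j = cutSum D white v i j := by
    intro i j hj
    simp only [cutSum, hv', Function.update_of_ne hj]
  by_cases ha : ∃ b, κ b = a
  swap
  · push Not at ha
    simp only [hne _ _ (ha _)] at hq
    obtain ⟨T, hT, hL⟩ := ih hι hκ hq
    refine ⟨T, fun c => ?_, hL.mono (Nat.le_succ _)⟩
    rw [hv', Function.update_of_ne (ha c)]
    exact hT c
  obtain ⟨b, rfl⟩ := ha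
  have hκne : ∀ c, c ≠ b → κ c ≠ κ b := fun c hc h => hc (hκ.injective h)
  obtain ⟨o, ho⟩ := exists_isRight white p (κ b)
  have hsum : ∀ i, cutSum D white v' i (κ b) = cutSum D white v i (κ b) +
      o.elim (if i = p then (D.t p (κ b) : R) else 0)
        (fun c => pathSum D white i (.sq p c) * (↑((D.t p c)⁻¹) * ↑(D.t p (κ b)))) := by
    intro i
    have : cutSum D white v' i (κ b) = pathSum D white i (.sq p (κ b)) := by
      simp [cutSum, hv']
    rw [this, pathSum_sq D i hw hv.isAbove ho]
    rfl
  set E : Matrix (Fin k) (Fin k) R := Matrix.of fun l c => if c = b then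
    o.elim (if ι l = p then (D.t p (κ b) : R) else 0)
      (fun c => pathSum D white (ι l) (.sq p c) * (↑((D.t p c)⁻¹) * ↑(D.t p (κ b))))
    else cutSum D white v (ι l) (κ c) with hE
  have finish : ∀ T : Fin k → CVertex m n,
      (∀ c, c ≠ b → ∃ r, v (κ c) = some r ∧ T c = .sq r (κ c)) → T b = .sq p (κ b) →
      ∀ c, ∃ r, v' (κ c) = some r ∧ T c = .sq r (κ c) := by
    intro T hT hTb c
    by_cases hc : c = b
    · subst hc
      exact ⟨p, by simp [hv'], hTb⟩
    · rw [hv', Function.update_of_ne (hκne c hc)]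
      exact hT c hc
  rw [qdet_add_col D.q (N := Matrix.of fun l c => cutSum D white v' (ι l) (κ c))
    (A := Matrix.of fun l c => cutSum D white v (ι l) (κ c)) (B := E) b
    (by simpa [hE] using fun l => hsum (ι l))
    (fun l c hc => (hne _ _ (hκne c hc)).symm)
    (fun l c hc => by simp [hE, hc, hne _ _ (hκne c hc)])] at hq
  by_cases hq1 : qdet D.q (Matrix.of fun l c => cutSum D white v (ι l) (κ c)) = 0
  swap
  · obtain ⟨T, hT, hL⟩ := ih hι hκ hq1
    obtain ⟨r, hr, hTb⟩ := hT b
    obtain ⟨h1, h2, h3⟩ := (hv.isAbove r).1 hr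
    refine ⟨Function.update T b (.sq p (κ b)), finish _ (fun c hc => ?_) (by simp), hL.extend ?_⟩
    · rw [Function.update_of_ne hc]
      exact hT c
    · rw [hTb]
      exact .vert r p (κ b) h1 h2 hw h3
  rw [hq1, zero_add] at hq
  cases o with
  | none =>
    have hp : ∃ l, ι l = p := by
      by_contra h
      push Not at h
      exact hq (qdet_eq_zero_of_col D.q b fun l => by simp [hE, h l])
    obtain ⟨l, rfl⟩ := hp
    cases k with
    | zero => exact l.elim0
    | succ k =>
      obtain rfl : l = Fin.last k := by
        by_contra hl
        have hlt : ι l < ι (Fin.last k) := hι (Fin.lt_last_iff_ne_last.2 hl)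
        refine hq (qdet_eq_zero_of_row D.q (Fin.last k) fun c => ?_)
        simp only [hE, Matrix.of_apply, Option.elim_none, hlt.ne', if_false]
        split_ifs
        · rfl
        · cases h : v (κ c) with
          | none => simp [cutSum, h]
          | some r =>
            obtain ⟨h1, h2, -⟩ := (hv (κ c) r).1 h
            have hr : r ≤ ι l := by
              rcases sqRank_lt_iff.1 h2 with h | h
              · exact h.le
              · exact h.1.le
            simp [cutSum, h, pathSum_sq_of_gt D h1 (hr.trans_lt hlt)]
      have hq2 : qdet D.q (Matrix.of fun l c : Fin k =>
          cutSum D white v (ι l.castSucc) (κ (b.succAbove c))) ≠ 0 := by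
        intro h
        refine hq (qdet_eq_zero_of_minor D.q b (fun l => ?_) ?_)
        · simp [hE, (hι (Fin.castSucc_lt_last l)).ne]
        · simpa [hE, Fin.succAbove_ne] using h
      obtain ⟨T, hT, hL⟩ := ih (hι.comp (Fin.strictMono_castSucc))
        (hκ.comp (Fin.strictMono_succAbove b)) hq2
      refine ⟨b.insertNth (α := fun _ => CVertex m n) (.sq (ι (Fin.last k)) (κ b)) T,
        finish _ (fun c hc => ?_) (by simp), hL.add_row hι (.fromRow _ _ hw ho.black_of_none)
          (b := b) (by simp) (by simp)⟩
      obtain ⟨c, rfl⟩ := Fin.exists_succAbove_eq hc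
      simpa using hT c
  | some d =>
    obtain ⟨hd, hwd, hbd⟩ := (ho d).1 rfl
    have hvd := hv.eq_some_of_right hd hwd
    have hcomm := fun i j hj => hv.qcomm_cutSum D hd hwd hbd i (j := j) hj
    have hEb : ∀ l, E l b = cutSum D white v (ι l) d *
        (↑((D.t p d)⁻¹) * ↑(D.t p (κ b))) := by
      intro l
      simp [hE, cutSum, hvd]
    have hEne : ∀ l c, c ≠ b → E l c = cutSum D white v (ι l) (κ c) := by
      intro l c hc
      simp [hE, hc]
    have hgap : ∀ c, b < c → d ≤ κ c := by
      intro c hc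
      by_contra h
      have hn := hv.eq_none_of_black hC hw (hκ hc) (hbd _ (hκ hc) (not_le.1 h))
      refine hq (qdet_eq_zero_of_col D.q c fun l => ?_)
      rw [hEne l c hc.ne']
      simp [cutSum, hn]
    by_cases hdκ : ∃ b', κ b' = d
    · obtain ⟨b', rfl⟩ := hdκ
      have hbb : b < b' := hκ.lt_iff_lt.1 hd
      have hadj : (b' : ℕ) = b + 1 := by
        by_contra h
        rw [Fin.lt_def] at hbb
        have h1 : (b : ℕ) + 1 < b' := by omega
        have h2 := hgap ⟨b + 1, h1.trans b'.2⟩ (by simp [Fin.lt_def])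
        exact absurd (hκ.le_iff_le.1 h2) (by simpa [Fin.le_def] using h1)
      refine absurd (qdet_eq_zero_of_adjacent D hadj
        (u := (↑((D.t p (κ b'))⁻¹) * ↑(D.t p (κ b)))) (fun l => ?_) fun l c hc => ?_) hq
      · rw [hEb, hEne l b' hbb.ne']
      · rw [hEne l c hc]
        simpa [hκ.injective.eq_iff] using hcomm (ι l) (κ c) (hκne c hc)
    · push Not at hdκ
      set κ' := Function.update κ b d with hκ'
      have hκ'mono : StrictMono κ' := by
        intro x y hxy
        simp only [hκ', Function.update_apply]
        split_ifs with h1 h2 h2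
        · exact absurd (h1.trans h2.symm) hxy.ne
        · subst h1
          exact lt_of_le_of_ne (hgap y hxy) (hdκ y).symm
        · subst h2
          exact (hκ hxy).trans hd
        · exact hκ hxy
      have hq2 : qdet D.q (Matrix.of fun l c => cutSum D white v (ι l) (κ' c)) ≠ 0 := by
        intro h
        refine hq ?_
        rw [qdet_mul_col D (N := E) (A := Matrix.of fun l c => cutSum D white v (ι l) (κ' c))
          (u := (↑((D.t p d)⁻¹) * ↑(D.t p (κ b)))) b, h, zero_mul]
        · intro l
          rw [hEb]
          simp [hκ']
        · intro l c hc
          rw [hEne l c hc]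
          simp [hκ', hc]
        · intro l c hc
          have := hcomm (ι l) (κ c) (hκne c hc)
          rw [if_neg (hdκ c)] at this
          simpa [hκ', hc] using this
      obtain ⟨T, hT, hL⟩ := ih hι hκ'mono hq2
      refine ⟨Function.update T b (.sq p (κ b)), finish _ (fun c hc => ?_) (by simp),
        hL.extend ?_⟩
      · have := hT c
        rw [hκ', Function.update_of_ne hc] at this
        rwa [Function.update_of_ne hc]
      · obtain ⟨r, hr, hTb⟩ := hT b
        rw [hκ', Function.update_self] at hr hTb
        obtain rfl : p = r := by simpa [hvd] using hr
        rw [hTb]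
        exact .horiz p d (κ b) hd hwd hw hbd

theorem exists_isCut_minorsLinked (D : QMData R m n) (hC : IsCauchon white) (s : ℕ) :
    ∃ v, IsCut white s v ∧ MinorsLinked D white s v := by
  induction s with
  | zero =>
    refine ⟨fun _ => none, fun j r => by simp, ?_⟩
    intro k ι κ _ _ hq
    cases k with
    | zero =>
      exact ⟨fun c => c.elim0, fun c => c.elim0, 1, fun c => c.elim0, fun c => c.elim0,
        fun c => c.elim0, fun c => c.elim0⟩
    | succ k => exact absurd (qdet_eq_zero_of_row D.q 0 fun c => by simp [cutSum]) hq
  | succ s ih =>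
    obtain ⟨v, hv, hL⟩ := ih
    by_cases h : ∃ p a, white p a = true ∧ sqRank p a = s
    · obtain ⟨p, a, hw, rfl⟩ := h
      exact ⟨_, hv.update hw, hL.update D hC hw hv⟩
    · push Not at h
      refine ⟨v, fun j r => ?_, fun k ι κ hι hκ hq => ?_⟩
      · have key : ∀ r, white r j = true → (sqRank r j < s + 1 ↔ sqRank r j < s) := by
          intro r hr
          have := h r j hr
          omega
        rw [hv j r]
        refine and_congr_right fun hr => ?_
        rw [key r hr]
        refine and_congr_right fun _ => forall₂_congr fun r' _ => ?_
        by_cases hr' : white r' j = true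
        · rw [key r' hr']
        · simp [hr']
      · obtain ⟨T, hT, hT'⟩ := hL hι hκ hq
        exact ⟨T, hT, hT'.mono (Nat.le_succ _)⟩

theorem IsCut.pathMatrix_eq_cutSum (D : QMData R m n) {v : Fin n → Option (Fin m)}
    (hv : IsCut white (m * n) v) (i : Fin m) (j : Fin n) :
    pathMatrix D white i j = cutSum D white v i j := by
  rw [pathMatrix_eq, pathSum_eq_finsum D i (by simp)]
  have hset : {u | CEdge white u (.col j : CVertex m n)} =
      {u | ∃ r, v j = some r ∧ u = .sq r j} := by
    ext u
    simp only [Set.mem_ofPred_eq]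
    constructor
    · intro e
      cases e with
      | toCol r j h1 h2 => exact ⟨r, (hv j r).2 ⟨h1, sqRank_lt r j, fun r' h _ => h2 r' h⟩, rfl⟩
    · rintro ⟨r, hr, rfl⟩
      obtain ⟨h1, -, h2⟩ := (hv j r).1 hr
      exact .toCol r j h1 fun r' h => h2 r' h (sqRank_lt r' j)
  rw [hset, cutSum]
  cases hr : v j with
  | none => simp
  | some r =>
    have : {u : CVertex m n | ∃ r', some r = some r' ∧ u = .sq r' j} = {.sq r j} := by
      ext u; simp
    rw [this, finsum_mem_singleton]
    simp [wt]

theorem exists_vertexDisjoint (D : QMData R m n) (hC : IsCauchon white) {k : ℕ}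
    {ι : Fin k → Fin m} {κ : Fin k → Fin n} (hι : StrictMono ι) (hκ : StrictMono κ)
    (hq : qdet D.q (Matrix.of fun a b : Fin k => pathMatrix D white (ι a) (κ b)) ≠ 0) :
    ∃ S : PathSys white ι κ, S.VertexDisjoint := by
  obtain ⟨v, hv, hL⟩ := exists_isCut_minorsLinked D hC (m * n)
  simp only [hv.pathMatrix_eq_cutSum D] at hq
  obtain ⟨T, hT, σ, P, h1, h2, h3⟩ := hL hι hκ hq
  refine ⟨⟨σ, fun l => P l ++ [.col (κ (σ l))], fun l => ?_⟩, fun a b hab x hx hy => ?_⟩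
  · refine isPathFrom_concat (h1 l) ?_
    obtain ⟨r, hr, hTr⟩ := hT (σ l)
    obtain ⟨h4, -, h5⟩ := (hv _ r).1 hr
    rw [hTr]
    exact .toCol r _ h4 fun r' h => h5 r' h (sqRank_lt r' _)
  · simp only [List.mem_append, List.mem_singleton] at hx hy
    rcases hx with hx | rfl
    · rcases hy with hy | rfl
      · exact h2 a b hab x hx hy
      · exact h3 a _ hx
    · rcases hy with hy | hy
      · exact h3 b _ hy
      · rw [CVertex.col.injEq] at hy
        exact hab (σ.injective (hκ.injective hy))

end Cuts

end CauchonGraph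

/-- if no vertex-disjoint `(R_I, C_J)`-path system exists, then
`det_q(M_C[I,J]) = 0`. -/
theorem qdet_eq_zero_of_no_disjoint_system {R : Type u} [Ring R] {m n : ℕ} (D : QMData R m n)
    (white : Fin m → Fin n → Bool) (hC : IsCauchon white)
    {k : ℕ} (ι : Fin k → Fin m) (κ : Fin k → Fin n)
    (hι : StrictMono ι) (hκ : StrictMono κ)
    (hno : ∀ S : PathSys white ι κ, ¬ S.VertexDisjoint) :
    qdet D.q (Matrix.of fun a b : Fin k => pathMatrix D white (ι a) (κ b)) = 0 := by
  by_contra hq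
  obtain ⟨S, hS⟩ := CauchonGraph.exists_vertexDisjoint D hC hι hκ hq
  exact hno S hS
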